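/- arXiv:2106.16078 — 3 statements merged into one kernel-verified Lean document; each statement's English description precedes it below -/
import Mathlib

section
/- Let Σ_A ∈ ℝ^{n²×n²} and Σ_B ∈ ℝ^{nm×nm} be positive semidefinite, with Σ̃_A' = P₁ Σ_A' Q₁ and Σ̃_B' = P₁ Σ_B' Q₂, and let S*(Σ̃_A'), S*(Σ̃_B'), and S*_Σ = S*(Σ̃_A') × S*(Σ̃_B') be the equivalence classes defined below. Then: (a) if n = m = 1, S*_Σ has a unique element; (b) if m = 1, S*(Σ̃_B') has a unique element; (c) if n ≥ 2 and Σ_A is positive definite, then S*(Σ̃_A') has infinitely many elements; (d) if m ≥ 2 and Σ_B is positive definite, then S*(Σ̃_B') has infinitely many elements; and under either condition (c) or (d), S*_Σ has infinitely many elements. -/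
open MeasureTheory ProbabilityTheory Matrix Filter

namespace MultNoise

lemma encLt {n p a b : ℕ} (ha : a < n) (hb : b < p) : a * p + b < n * p := by
  calc a * p + b < a * p + p := by omega
    _ = (a + 1) * p := by ring
    _ ≤ n * p := Nat.mul_le_mul_right p ha

lemma triLt {n i j : ℕ} (hi : i < n) (hj : j < n) :
    i * n + j - i * (i + 1) / 2 < n * (n + 1) / 2 := by
  obtain ⟨k, hk⟩ := Nat.even_mul_succ_self i
  obtain ⟨l, hl⟩ := Nat.even_mul_succ_self n
  have hiZ : (i : ℤ) < n := by exact_mod_cast hi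
  have hjZ : (j : ℤ) < n := by exact_mod_cast hj
  have hkZ : (i : ℤ) * (i + 1) = k + k := by exact_mod_cast hk
  have hlZ : (n : ℤ) * (n + 1) = l + l := by exact_mod_cast hl
  have key : (i : ℤ) * n + j < l + k := by nlinarith [sq_nonneg ((n : ℤ) - i - 1)]
  have keyN : i * n + j < l + k := by exact_mod_cast key
  have hl0 : 0 < l := by
    have h2 : 1 * 2 ≤ n * (n + 1) := Nat.mul_le_mul (by omega) (by omega)
    omega
  omega

lemma pos_of_lt_mul {a c r : ℕ} (h : r < a * c) : 0 < c := by
  rcases Nat.eq_zero_or_pos c with h0 | h1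
  · subst h0; simp at h
  · exact h1

lemma div_lt_of_lt_mul' {a c r : ℕ} (h : r < a * c) : r / c < a :=
  Nat.div_lt_of_lt_mul (by rwa [Nat.mul_comm] at h)

/-- `idx2 i j` is the (0-indexed) position `i * p + j`, i.e. the vectorization index of the
entry in column `i` and row `j` (for `vec` of an `p × n`... used generically). -/
def idx2 {n p : ℕ} (i : Fin n) (j : Fin p) : Fin (n * p) :=
  ⟨i.val * p + j.val, encLt i.isLt j.isLt⟩

/-- position of the pair `(i,j)` in the half-vectorization enumeration. -/
def tri (n : ℕ) (i j : Fin n) : Fin (n * (n + 1) / 2) :=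
  ⟨i.val * n + j.val - i.val * (i.val + 1) / 2, triLt i.isLt j.isLt⟩

/-- Column-stacking vectorization: `vecM M ⟨j*a+i⟩ = M i j`. -/
def vecM {a b : ℕ} (M : Matrix (Fin a) (Fin b) ℝ) : Fin (b * a) → ℝ :=
  fun k => M ⟨k.val % a, Nat.mod_lt _ (pos_of_lt_mul k.isLt)⟩ ⟨k.val / a, div_lt_of_lt_mul' k.isLt⟩

/-- Kronecker product with `Fin` index arithmetic. -/
def kron {a b c d : ℕ} (M : Matrix (Fin a) (Fin b) ℝ) (N : Matrix (Fin c) (Fin d) ℝ) :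
    Matrix (Fin (a * c)) (Fin (b * d)) ℝ :=
  fun r s =>
    M ⟨r.val / c, div_lt_of_lt_mul' r.isLt⟩ ⟨s.val / d, div_lt_of_lt_mul' s.isLt⟩ *
    N ⟨r.val % c, Nat.mod_lt _ (pos_of_lt_mul r.isLt)⟩ ⟨s.val % d, Nat.mod_lt _ (pos_of_lt_mul s.isLt)⟩

/-- Elimination matrix `P₁` (deleting redundant rows of the identity). -/
def Pmat (n : ℕ) : Matrix (Fin (n * (n + 1) / 2)) (Fin (n * n)) ℝ :=
  fun r c => if ∃ i j : Fin n, i ≤ j ∧ r = tri n i j ∧ c = idx2 i j then 1 else 0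

/-- index of the mirrored entry. -/
def symIdx (n : ℕ) (r : Fin (n * n)) : Fin (n * n) :=
  if r.val % n < r.val / n then
    ⟨(r.val % n) * n + r.val / n,
      encLt (Nat.mod_lt _ (pos_of_lt_mul r.isLt)) (div_lt_of_lt_mul' r.isLt)⟩
  else r

/-- Symmetrization matrix `T₁`. -/
def Tmat (n : ℕ) : Matrix (Fin (n * n)) (Fin (n * n)) ℝ :=
  fun r c => if c = symIdx n r then 1 else 0

/-- Duplication matrix `Q₁` (deleting columns of `T₁`). -/
def Qmat (n : ℕ) : Matrix (Fin (n * n)) (Fin (n * (n + 1) / 2)) ℝ :=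
  fun r c => if ∃ i j : Fin n, i ≤ j ∧ c = tri n i j ∧ symIdx n r = idx2 i j then 1 else 0

/-- spectral norm of a real matrix. -/
noncomputable def spec {a b : ℕ} (M : Matrix (Fin a) (Fin b) ℝ) : ℝ :=
  ‖LinearMap.toContinuousLinearMap (Matrix.toEuclideanLin M)‖

/-- Euclidean norm of a vector. -/
noncomputable def vnorm {k : ℕ} (v : Fin k → ℝ) : ℝ := Real.sqrt (∑ i, v i ^ 2)

/-- largest "eigenvalue" (supremum of the Rayleigh quotient over the unit sphere). -/
noncomputable def lamMax {k : ℕ} (M : Matrix (Fin k) (Fin k) ℝ) : ℝ :=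
  sSup {r : ℝ | ∃ v : Fin k → ℝ, (∑ i, v i ^ 2) = 1 ∧ v ⬝ᵥ M.mulVec v = r}

/-- smallest "eigenvalue" (infimum of the Rayleigh quotient over the unit sphere). -/
noncomputable def lamMin {k : ℕ} (M : Matrix (Fin k) (Fin k) ℝ) : ℝ :=
  sInf {r : ℝ | ∃ v : Fin k → ℝ, (∑ i, v i ^ 2) = 1 ∧ v ⬝ᵥ M.mulVec v = r}

/-- time-varying linear dynamical system recursion. -/
def ldsTV {d : ℕ} (M : ℕ → Matrix (Fin d) (Fin d) ℝ) (g : ℕ → Fin d → ℝ)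
    (x0 : Fin d → ℝ) : ℕ → Fin d → ℝ
  | 0 => x0
  | t + 1 => (M t).mulVec (ldsTV M g x0 t) + g t


section EquivClass

variable {Ω : Type*} [MeasureSpace Ω] {n m : ℕ}

/-- `Σ_A' = E[Ā ⊗ Ā]`. -/
noncomputable def SigmaAp (Ab : Ω → Matrix (Fin n) (Fin n) ℝ) :
    Matrix (Fin (n * n)) (Fin (n * n)) ℝ :=
  fun r c => ∫ ω, kron (Ab ω) (Ab ω) r c

/-- `Σ_B' = E[B̄ ⊗ B̄]`. -/
noncomputable def SigmaBp (Bb : Ω → Matrix (Fin n) (Fin m) ℝ) :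
    Matrix (Fin (n * n)) (Fin (m * m)) ℝ :=
  fun r c => ∫ ω, kron (Bb ω) (Bb ω) r c

/-- `Σ_A = E[vec(Ā) vec(Ā)ᵀ]`. -/
noncomputable def SigmaA (Ab : Ω → Matrix (Fin n) (Fin n) ℝ) :
    Matrix (Fin (n * n)) (Fin (n * n)) ℝ :=
  fun r c => ∫ ω, vecM (Ab ω) r * vecM (Ab ω) c

/-- `Σ_B = E[vec(B̄) vec(B̄)ᵀ]`. -/
noncomputable def SigmaB (Bb : Ω → Matrix (Fin n) (Fin m) ℝ) :
    Matrix (Fin (m * n)) (Fin (m * n)) ℝ :=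
  fun r c => ∫ ω, vecM (Bb ω) r * vecM (Bb ω) c

/-- The block-reshaping operator `F` of the paper: for a block matrix `B ∈ ℝ^{mb·p × nb·q}`
with `p × q` blocks `B_{ij}`, row `(j-1)mb + i` of `F(B)` is `vec(B_{ij})ᵀ`. -/
def Fop (mb nb p q : ℕ) (B : Matrix (Fin (mb * p)) (Fin (nb * q)) ℝ) :
    Matrix (Fin (nb * mb)) (Fin (q * p)) ℝ :=
  fun r c =>
    B ⟨(r.val % mb) * p + c.val % p,
        encLt (Nat.mod_lt _ (pos_of_lt_mul r.isLt)) (Nat.mod_lt _ (pos_of_lt_mul c.isLt))⟩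
      ⟨(r.val / mb) * q + c.val / p,
        encLt (div_lt_of_lt_mul' r.isLt) (div_lt_of_lt_mul' c.isLt)⟩

/-- The diagonal matrix `D_n` with `((i−1)n+i)`-th diagonal entries `1`, others `1/2`. -/
noncomputable def DiagD (k : ℕ) : Matrix (Fin (k * k)) (Fin (k * k)) ℝ :=
  fun r c => if r = c then (if r.val % k = r.val / k then (1 : ℝ) else 1 / 2) else 0

/-- `e_{(i−1)n+j} − e_{(j−1)n+i}` as a vector. -/
noncomputable def uvec (n : ℕ) (i j : Fin n) : Fin (n * n) → ℝ :=
  fun r => (if r = idx2 i j then (1 : ℝ) else 0) - (if r = idx2 j i then (1 : ℝ) else 0)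

/-- `E_α = Σ_{i<j,k<l} α_{ij,kl}(e_{(i−1)n+j} − e_{(j−1)n+i})(e_{(k−1)n+l} − e_{(l−1)n+k})ᵀ`. -/
noncomputable def EmatA (n : ℕ) (α : Fin n → Fin n → Fin n → Fin n → ℝ) :
    Matrix (Fin (n * n)) (Fin (n * n)) ℝ :=
  fun r c => ∑ i, ∑ j, ∑ k, ∑ l,
    (if i < j ∧ k < l then α i j k l else 0) * (uvec n i j r * uvec n k l c)

/-- `E_β = Σ_{i<j,p<q} β_{ij,pq}(e_{(i−1)n+j} − e_{(j−1)n+i})(e_{(p−1)m+q} − e_{(q−1)m+p})ᵀ`. -/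
noncomputable def EmatB (n m : ℕ) (β : Fin n → Fin n → Fin m → Fin m → ℝ) :
    Matrix (Fin (n * n)) (Fin (m * m)) ℝ :=
  fun r c => ∑ i, ∑ j, ∑ p, ∑ q,
    (if i < j ∧ p < q then β i j p q else 0) * (uvec n i j r * uvec m p q c)

/-- `Σ_A(α) = F(Q₁ Σ̃_A' Q₁ᵀ D_n + E_α)`. -/
noncomputable def SigmaAof (Ab : Ω → Matrix (Fin n) (Fin n) ℝ)
    (α : Fin n → Fin n → Fin n → Fin n → ℝ) : Matrix (Fin (n * n)) (Fin (n * n)) ℝ :=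
  Fop n n n n
    (Qmat n * (Pmat n * SigmaAp Ab * Qmat n) * (Qmat n)ᵀ * DiagD n + EmatA n α)

/-- `Σ_B(β) = F(Q₁ Σ̃_B' Q₂ᵀ D_m + E_β)`. -/
noncomputable def SigmaBof (Bb : Ω → Matrix (Fin n) (Fin m) ℝ)
    (β : Fin n → Fin n → Fin m → Fin m → ℝ) : Matrix (Fin (m * n)) (Fin (m * n)) ℝ :=
  Fop n m n m
    (Qmat n * (Pmat n * SigmaBp Bb * Qmat m) * (Qmat m)ᵀ * DiagD m + EmatB n m β)

/-- The equivalence class `S*(Σ̃_A')`. -/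
noncomputable def SstarA (Ab : Ω → Matrix (Fin n) (Fin n) ℝ) :
    Set (Matrix (Fin (n * n)) (Fin (n * n)) ℝ) :=
  {S | ∃ α : Fin n → Fin n → Fin n → Fin n → ℝ, S = SigmaAof Ab α ∧ S.PosSemidef}

/-- The equivalence class `S*(Σ̃_B')`. -/
noncomputable def SstarB (Bb : Ω → Matrix (Fin n) (Fin m) ℝ) :
    Set (Matrix (Fin (m * n)) (Fin (m * n)) ℝ) :=
  {S | ∃ β : Fin n → Fin n → Fin m → Fin m → ℝ, S = SigmaBof Bb β ∧ S.PosSemidef}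

end EquivClass

end MultNoise

namespace MultNoise

section Index

variable {n m p : ℕ}

lemma idx2_eq_finProdFinEquiv (i : Fin n) (j : Fin p) : idx2 i j = finProdFinEquiv (i, j) := by
  ext
  simp [idx2, finProdFinEquiv]
  ring

lemma idx2_inj {i k : Fin n} {j l : Fin p} : idx2 i j = idx2 k l ↔ i = k ∧ j = l := by
  simp [idx2_eq_finProdFinEquiv]

lemma exists_idx2 (r : Fin (n * p)) : ∃ i j, r = idx2 i j := by
  obtain ⟨⟨i, j⟩, h⟩ := finProdFinEquiv.surjective r
  exact ⟨i, j, by rw [idx2_eq_finProdFinEquiv, h]⟩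

lemma sum_idx2 (f : Fin (n * p) → ℝ) : ∑ r, f r = ∑ i, ∑ j, f (idx2 i j) := by
  rw [← finProdFinEquiv.sum_comp, Fintype.sum_prod_type]
  simp [idx2_eq_finProdFinEquiv]

lemma idx2_val_mod (i : Fin n) (j : Fin p) : (idx2 i j).val % p = j.val := by
  simp [idx2, Nat.mod_eq_of_lt j.isLt]

lemma idx2_val_div (i : Fin n) (j : Fin p) : (idx2 i j).val / p = i.val := by
  have hp : 0 < p := j.pos
  simp only [idx2]
  rw [Nat.add_comm, Nat.add_mul_div_right _ _ hp, Nat.div_eq_of_lt j.isLt, Nat.zero_add]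

lemma symIdx_idx2 (a b : Fin n) : symIdx n (idx2 a b) = idx2 (min a b) (max a b) := by
  unfold symIdx
  simp only [idx2_val_mod, idx2_val_div]
  split_ifs with h
  · rw [min_eq_right (Fin.le_def.2 h.le), max_eq_left (Fin.le_def.2 h.le)]
    rfl
  · rw [min_eq_left (Fin.le_def.2 (not_lt.1 h)), max_eq_right (Fin.le_def.2 (not_lt.1 h))]

lemma tri_lt_tri {i j k l : Fin n} (hkl : k ≤ l) (hik : i < k) : tri n i j < tri n k l := by
  obtain ⟨s, hs⟩ := Nat.even_mul_succ_self i.val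
  obtain ⟨t, ht⟩ := Nat.even_mul_succ_self k.val
  have hk := k.isLt
  have hj := j.isLt
  simp only [Fin.lt_def, Fin.le_def, tri] at *
  have hsn : s ≤ i.val * n := by nlinarith
  have htn : t ≤ k.val * n := by nlinarith
  have key : i.val * n + j.val + t < k.val * n + l.val + s := by
    zify at *
    nlinarith [mul_nonneg (sub_nonneg.2 (Int.add_one_le_iff.2 hik))
      (sub_nonneg.2 (Int.add_one_le_iff.2 hk))]
  omega

lemma tri_inj {i j k l : Fin n} (hij : i ≤ j) (hkl : k ≤ l) :
    tri n i j = tri n k l ↔ i = k ∧ j = l := by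
  refine ⟨fun h => ?_, by rintro ⟨rfl, rfl⟩; rfl⟩
  rcases lt_trichotomy i k with hlt | rfl | hlt
  · exact absurd h (tri_lt_tri hkl hlt).ne
  · refine ⟨rfl, ?_⟩
    obtain ⟨s, hs⟩ := Nat.even_mul_succ_self i.val
    have hi := i.isLt
    have hsn : s ≤ i.val * n := by nlinarith
    simp only [tri, Fin.mk.injEq] at h
    ext
    omega
  · exact absurd h (tri_lt_tri hij hlt).ne'

end Index

section Entries

variable {n m : ℕ}

lemma Qmat_idx2 (a b : Fin n) (c : Fin (n * (n + 1) / 2)) :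
    Qmat n (idx2 a b) c = if c = tri n (min a b) (max a b) then 1 else 0 := by
  unfold Qmat
  refine if_congr ?_ rfl rfl
  rw [symIdx_idx2]
  constructor
  · rintro ⟨i, j, -, hc, h⟩
    obtain ⟨h1, h2⟩ := idx2_inj.1 h
    rw [hc, h1, h2]
  · exact fun h => ⟨_, _, min_le_max, h, rfl⟩

lemma Pmat_tri {i j : Fin n} (hij : i ≤ j) (c : Fin (n * n)) :
    Pmat n (tri n i j) c = if c = idx2 i j then 1 else 0 := by
  unfold Pmat
  refine if_congr ⟨?_, fun h => ⟨i, j, hij, rfl, h⟩⟩ rfl rfl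
  rintro ⟨k, l, hkl, h, hc⟩
  obtain ⟨rfl, rfl⟩ := (tri_inj hij hkl).1 h
  exact hc

lemma Qmat_mul_apply {κ : Type*} (M : Matrix (Fin (n * (n + 1) / 2)) κ ℝ) (a b : Fin n) (c : κ) :
    (Qmat n * M) (idx2 a b) c = M (tri n (min a b) (max a b)) c := by
  simp [Matrix.mul_apply, Qmat_idx2]

lemma mul_Qmat_transpose_apply {κ : Type*} (M : Matrix κ (Fin (n * (n + 1) / 2)) ℝ) (r : κ)
    (c d : Fin n) :
    (M * (Qmat n)ᵀ) r (idx2 c d) = M r (tri n (min c d) (max c d)) := by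
  simp [Matrix.mul_apply, Qmat_idx2]

lemma Pmat_mul_apply {κ : Type*} (M : Matrix (Fin (n * n)) κ ℝ) {i j : Fin n} (hij : i ≤ j)
    (c : κ) : (Pmat n * M) (tri n i j) c = M (idx2 i j) c := by
  simp [Matrix.mul_apply, Pmat_tri hij]

lemma mul_DiagD_apply {κ : Type*} (M : Matrix κ (Fin (n * n)) ℝ) (r : κ) (c d : Fin n) :
    (M * DiagD n) r (idx2 c d) = M r (idx2 c d) * if c = d then 1 else 1 / 2 := by
  have h : (d.val = c.val) ↔ c = d := by rw [Fin.ext_iff, eq_comm]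
  rw [Matrix.mul_apply, Finset.sum_eq_single (idx2 c d)]
  · simp only [DiagD, if_true, idx2_val_mod, idx2_val_div, h]
  · intro b _ hb
    simp [DiagD, hb]
  · simp

lemma mul_Qmat_apply {κ : Type*} (M : Matrix κ (Fin (n * n)) ℝ) (r : κ) (c d : Fin n) :
    (M * Qmat n) r (tri n (min c d) (max c d)) * (if c = d then 1 else 1 / 2) =
      (M r (idx2 c d) + M r (idx2 d c)) / 2 := by
  have h : ∀ a b : Fin n, (if tri n (min c d) (max c d) = tri n (min a b) (max a b)
      then (1 : ℝ) else 0) =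
      (if a = c then if b = d then 1 else 0 else 0) +
        (if a = d then if b = c then 1 else 0 else 0) -
        if c = d then if a = c then if b = c then 1 else 0 else 0 else 0 := by
    intro a b
    simp only [tri_inj min_le_max min_le_max]
    rcases le_total c d with h1 | h1 <;> rcases le_total a b with h2 | h2 <;>
      simp only [h1, h2, min_eq_left, min_eq_right, max_eq_left, max_eq_right] <;>
      split_ifs <;> first | (exfalso; omega) | norm_num
  rw [Matrix.mul_apply, sum_idx2]
  simp only [Qmat_idx2, h, mul_sub, mul_add, Finset.sum_sub_distrib, Finset.sum_add_distrib]
  by_cases hcd : c = d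
  · subst hcd
    simp
  · simp [hcd]
    ring

/-- The product `Q₁ (P₁ M Q₂) Q₂ᵀ D` symmetrizes the column index and sorts the row index. -/
lemma symmetrized_apply (M : Matrix (Fin (n * n)) (Fin (m * m)) ℝ) (a b : Fin n) (c d : Fin m) :
    (Qmat n * (Pmat n * M * Qmat m) * (Qmat m)ᵀ * DiagD m) (idx2 a b) (idx2 c d) =
      (M (idx2 (min a b) (max a b)) (idx2 c d) + M (idx2 (min a b) (max a b)) (idx2 d c)) / 2 := by
  rw [mul_DiagD_apply, mul_Qmat_transpose_apply, Qmat_mul_apply, Matrix.mul_assoc,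
    Pmat_mul_apply _ min_le_max, mul_Qmat_apply]

lemma uvec_idx2 (i j a b : Fin n) :
    uvec n i j (idx2 a b) =
      (if i = a then if j = b then 1 else 0 else 0) -
        if j = a then if i = b then 1 else 0 else 0 := by
  simp only [uvec, idx2_inj, ite_and, @eq_comm _ a, @eq_comm _ b]

lemma sum_lt_mul_uvec {f : Fin n → Fin n → ℝ} (hf : ∀ i j, f j i = -f i j) (a b : Fin n) :
    ∑ i, ∑ j, (if i < j then f i j else 0) * uvec n i j (idx2 a b) = f a b := by
  have h0 : f a a = 0 := by linarith [hf a a]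
  have h : ∀ i j, (if i < j then f i j else 0) * uvec n i j (idx2 a b) =
      (if i = a then if j = b then (if a < b then f a b else 0) else 0 else 0) -
        (if i = b then if j = a then (if b < a then f b a else 0) else 0 else 0) := by
    intro i j
    rw [uvec_idx2]
    clear hf
    split_ifs <;> subst_vars <;> first | (exfalso; omega) | simp
  simp only [h, Finset.sum_sub_distrib]
  rcases lt_trichotomy a b with hab | rfl | hab
  · simp [hab, hab.not_gt]
  · simp [h0]
  · simp [hab, hab.not_gt, hf a b]

lemma EmatB_idx2 {β : Fin n → Fin n → Fin m → Fin m → ℝ}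
    (h₁ : ∀ i j p q, β j i p q = -β i j p q) (h₂ : ∀ i j p q, β i j q p = -β i j p q)
    (a b : Fin n) (c d : Fin m) :
    EmatB n m β (idx2 a b) (idx2 c d) = β a b c d := by
  rw [← sum_lt_mul_uvec (f := fun i j => β i j c d) (fun i j => h₁ i j c d) a b]
  unfold EmatB
  refine Finset.sum_congr rfl fun i _ => Finset.sum_congr rfl fun j _ => ?_
  rw [← sum_lt_mul_uvec (f := fun p q => β i j p q) (fun p q => h₂ i j p q) c d]
  split_ifs with hij
  · simp only [hij, true_and, Finset.sum_mul]
    refine Finset.sum_congr rfl fun p _ => Finset.sum_congr rfl fun q _ => ?_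
    ring
  · simp [hij]

end Entries

section Covariance

variable {Ω : Type*} [MeasureSpace Ω] {n m : ℕ}

lemma SigmaBp_idx2 (Bb : Ω → Matrix (Fin n) (Fin m) ℝ) (i j : Fin n) (p q : Fin m) :
    SigmaBp Bb (idx2 i j) (idx2 p q) = ∫ ω, Bb ω i p * Bb ω j q := by
  simp only [SigmaBp, kron, idx2_val_mod, idx2_val_div, Fin.eta]

lemma SigmaB_idx2 (Bb : Ω → Matrix (Fin n) (Fin m) ℝ) (i j : Fin n) (p q : Fin m) :
    SigmaB Bb (idx2 p i) (idx2 q j) = ∫ ω, Bb ω i p * Bb ω j q := by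
  simp only [SigmaB, vecM, idx2_val_mod, idx2_val_div, Fin.eta]

lemma SigmaBp_idx2_swap (Bb : Ω → Matrix (Fin n) (Fin m) ℝ) (i j : Fin n) (p q : Fin m) :
    SigmaBp Bb (idx2 j i) (idx2 q p) = SigmaBp Bb (idx2 i j) (idx2 p q) := by
  simp only [SigmaBp_idx2, mul_comm]

lemma Fop_idx2 (M : Matrix (Fin (n * n)) (Fin (m * m)) ℝ) (i j : Fin n) (p q : Fin m) :
    Fop n m n m M (idx2 p i) (idx2 q j) = M (idx2 i j) (idx2 p q) := by
  simp only [Fop, idx2_val_mod, idx2_val_div]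
  rfl

/-- `Σ_B` may be perturbed by any reshaped doubly antisymmetric matrix. -/
lemma exists_SigmaBof_eq_add (Bb : Ω → Matrix (Fin n) (Fin m) ℝ)
    {δ : Fin n → Fin n → Fin m → Fin m → ℝ} {H : Matrix (Fin (m * n)) (Fin (m * n)) ℝ}
    (h₁ : ∀ i j p q, δ j i p q = -δ i j p q) (h₂ : ∀ i j p q, δ i j q p = -δ i j p q)
    (hH : ∀ i j p q, H (idx2 p i) (idx2 q j) = δ i j p q) :
    ∃ β, SigmaBof Bb β = SigmaB Bb + H := by
  refine ⟨fun i j p q =>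
    (SigmaBp Bb (idx2 i j) (idx2 p q) - SigmaBp Bb (idx2 j i) (idx2 p q)) / 2 + δ i j p q, ?_⟩
  ext r c
  obtain ⟨p, i, rfl⟩ := exists_idx2 r
  obtain ⟨q, j, rfl⟩ := exists_idx2 c
  rw [SigmaBof, Fop_idx2, Matrix.add_apply, Matrix.add_apply, hH, symmetrized_apply, EmatB_idx2]
  · rw [SigmaB_idx2, ← SigmaBp_idx2]
    rcases le_total i j with h | h
    · rw [min_eq_left h, max_eq_right h, ← SigmaBp_idx2_swap Bb j i p q]
      ring
    · rw [min_eq_right h, max_eq_left h, ← SigmaBp_idx2_swap Bb i j p q]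
      ring
  · intro i j p q
    rw [h₁]
    ring
  · intro i j p q
    rw [h₂, SigmaBp_idx2_swap Bb j i p q, SigmaBp_idx2_swap Bb i j p q]
    ring

lemma exists_SigmaBof_eq (Bb : Ω → Matrix (Fin n) (Fin m) ℝ) :
    ∃ β, SigmaBof Bb β = SigmaB Bb := by
  simpa using exists_SigmaBof_eq_add Bb (δ := 0) (H := 0) (by simp) (by simp) (by simp)

lemma SigmaB_mem_SstarB {Bb : Ω → Matrix (Fin n) (Fin m) ℝ} (h : (SigmaB Bb).PosSemidef) :
    SigmaB Bb ∈ SstarB Bb := by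
  obtain ⟨β, hβ⟩ := exists_SigmaBof_eq Bb
  exact ⟨β, hβ.symm, h⟩

lemma existsUnique_mem_SstarB (hm : m = 1) {Bb : Ω → Matrix (Fin n) (Fin m) ℝ}
    (h : (SigmaB Bb).PosSemidef) : ∃! S, S ∈ SstarB Bb := by
  subst hm
  have hE : ∀ β β', EmatB n 1 β = EmatB n 1 β' := by
    intro β β'
    ext r c
    simp [EmatB]
  refine ⟨SigmaB Bb, SigmaB_mem_SstarB h, ?_⟩
  rintro S ⟨β, rfl, -⟩
  obtain ⟨β', hβ'⟩ := exists_SigmaBof_eq Bb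
  rw [← hβ', SigmaBof, SigmaBof, hE β β']

end Covariance

lemma PosDef.exists_add_smul_posSemidef {ι : Type*} [Fintype ι] {S H : Matrix ι ι ℝ}
    (hS : S.PosDef) (hH : H.IsHermitian) :
    ∃ ε : ℝ, 0 < ε ∧ ∀ t : ℝ, 0 ≤ t → t ≤ ε → (S + t • H).PosSemidef := by
  have hcont : ∀ M : Matrix ι ι ℝ, Continuous fun x : ι → ℝ => x ⬝ᵥ M *ᵥ x := fun M => by
    fun_prop
  have hSpos : ∀ x : ι → ℝ, x ≠ 0 → 0 < x ⬝ᵥ S *ᵥ x := fun x hx => by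
    simpa using hS.dotProduct_mulVec_pos hx
  obtain ⟨C, hC⟩ := (isCompact_sphere (0 : ι → ℝ) 1).bddAbove_image
    (f := fun x => -(x ⬝ᵥ H *ᵥ x) / (x ⬝ᵥ S *ᵥ x))
    (((hcont H).neg.continuousOn).div (hcont S).continuousOn fun x hx =>
      (hSpos x (ne_zero_of_mem_unit_sphere ⟨x, hx⟩)).ne')
  refine ⟨1 / (|C| + 1), by positivity, fun t ht0 ht => ?_⟩
  refine Matrix.PosSemidef.of_dotProduct_mulVec_nonneg
    (hS.1.add (hH.smul (IsSelfAdjoint.all t))) fun x => ?_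
  rcases eq_or_ne x 0 with rfl | hx
  · simp
  have hmem : ‖x‖⁻¹ • x ∈ Metric.sphere (0 : ι → ℝ) 1 := by
    simp [norm_smul, inv_mul_cancel₀ (norm_ne_zero_iff.2 hx)]
  have hle := hC (Set.mem_image_of_mem _ hmem)
  have hnx : ‖x‖⁻¹ ≠ 0 := inv_ne_zero (norm_ne_zero_iff.2 hx)
  simp only [Matrix.mulVec_smul, dotProduct_smul, smul_dotProduct, smul_eq_mul, ← mul_neg,
    mul_div_mul_left _ _ hnx] at hle
  rw [div_le_iff₀ (hSpos x hx)] at hle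
  rw [le_div_iff₀ (by positivity)] at ht
  have hf := hSpos x hx
  have htC : t * C ≤ 1 := by nlinarith [le_abs_self C]
  simp only [star_trivial, Matrix.add_mulVec, Matrix.smul_mulVec, dotProduct_add,
    dotProduct_smul, smul_eq_mul]
  nlinarith [mul_le_mul_of_nonneg_left hle ht0, mul_le_mul_of_nonneg_right htC hf.le]

section Infinite

variable {Ω : Type*} [MeasureSpace Ω] {n m : ℕ}

/-- The skew-symmetric matrix unit `e_i e_jᵀ - e_j e_iᵀ`. -/
def skewUnit (i j : Fin n) (a b : Fin n) : ℝ :=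
  (if a = i ∧ b = j then 1 else 0) - if a = j ∧ b = i then 1 else 0

lemma skewUnit_swap (i j a b : Fin n) : skewUnit i j b a = -skewUnit i j a b := by
  simp only [skewUnit, and_comm]
  ring

lemma SstarB_infinite (hn : 2 ≤ n) (hm : 2 ≤ m) {Bb : Ω → Matrix (Fin n) (Fin m) ℝ}
    (h : (SigmaB Bb).PosDef) : (SstarB Bb).Infinite := by
  let u : Fin n → Fin n → ℝ := skewUnit ⟨0, by omega⟩ ⟨1, by omega⟩
  let v : Fin m → Fin m → ℝ := skewUnit ⟨0, by omega⟩ ⟨1, by omega⟩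
  have hu : ∀ i j, u j i = -u i j := skewUnit_swap _ _
  have hv : ∀ p q, v q p = -v p q := skewUnit_swap _ _
  let H : Matrix (Fin (m * n)) (Fin (m * n)) ℝ :=
    Fop n m n m (EmatB n m fun i j p q => u i j * v p q)
  have hHapp : ∀ i j p q, H (idx2 p i) (idx2 q j) = u i j * v p q := by
    intro i j p q
    simp only [H, Fop_idx2]
    exact EmatB_idx2 (fun i j p q => by rw [hu i j]; ring) (fun i j p q => by rw [hv p q]; ring)
      i j p q
  have hH : H.IsHermitian := by
    ext r c
    obtain ⟨p, i, rfl⟩ := exists_idx2 r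
    obtain ⟨q, j, rfl⟩ := exists_idx2 c
    rw [Matrix.conjTranspose_apply, hHapp, hHapp, hu i j, hv p q]
    simp
  obtain ⟨ε, hε, hpos⟩ := PosDef.exists_add_smul_posSemidef h hH
  have hinj : Function.Injective fun t : ℝ => SigmaB Bb + t • H := by
    intro s t hst
    have := congrFun₂ (add_left_cancel (G := Matrix _ _ ℝ) hst) (idx2 ⟨0, by omega⟩ ⟨0, by omega⟩)
      (idx2 ⟨1, by omega⟩ ⟨1, by omega⟩)
    simpa [hHapp, u, v, skewUnit] using this
  refine ((Set.Icc_infinite hε).image hinj.injOn).mono ?_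
  rintro _ ⟨t, ⟨ht0, ht⟩, rfl⟩
  obtain ⟨β, hβ⟩ := exists_SigmaBof_eq_add Bb (δ := fun i j p q => t * (u i j * v p q))
    (H := t • H) (fun i j p q => by rw [hu i j]; ring) (fun i j p q => by rw [hv p q]; ring)
    (fun i j p q => by simp [hHapp])
  exact ⟨β, hβ.symm, hpos t ht0 ht⟩

end Infinite

/-- Proposition 2 of the paper: uniqueness/non-uniqueness of the
equivalence class of noise covariance matrices. -/
theorem statement1 {Ω : Type*} [MeasureSpace Ω] [IsProbabilityMeasure (volume : Measure Ω)]
    {n m : ℕ} (hmn : m ≤ n)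
    (Ab : Ω → Matrix (Fin n) (Fin n) ℝ) (Bb : Ω → Matrix (Fin n) (Fin m) ℝ)
    (hAint : ∀ i j k l : Fin n, Integrable (fun ω => Ab ω i k * Ab ω j l))
    (hBint : ∀ (i j : Fin n) (p q : Fin m), Integrable (fun ω => Bb ω i p * Bb ω j q))
    (hSA : (SigmaA Ab).PosSemidef) (hSB : (SigmaB Bb).PosSemidef) :
    ((n = 1 ∧ m = 1) → (∃! x, x ∈ (SstarA Ab) ×ˢ (SstarB Bb))) ∧
    (m = 1 → (∃! S, S ∈ SstarB Bb)) ∧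
    (2 ≤ n → (SigmaA Ab).PosDef → (SstarA Ab).Infinite) ∧
    (2 ≤ m → (SigmaB Bb).PosDef → (SstarB Bb).Infinite) ∧
    (((2 ≤ n ∧ (SigmaA Ab).PosDef) ∨ (2 ≤ m ∧ (SigmaB Bb).PosDef)) →
      ((SstarA Ab) ×ˢ (SstarB Bb)).Infinite) := by
  have hA : (SstarA Ab).Nonempty := ⟨_, SigmaB_mem_SstarB hSA⟩
  have hB : (SstarB Bb).Nonempty := ⟨_, SigmaB_mem_SstarB hSB⟩
  have hAinf : 2 ≤ n → (SigmaA Ab).PosDef → (SstarA Ab).Infinite :=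
    fun hn h => SstarB_infinite hn hn h
  have hBinf : 2 ≤ m → (SigmaB Bb).PosDef → (SstarB Bb).Infinite :=
    fun hm h => SstarB_infinite (hm.trans hmn) hm h
  refine ⟨?_, fun hm => existsUnique_mem_SstarB hm hSB, hAinf, hBinf, ?_⟩
  · rintro ⟨hn, hm⟩
    obtain ⟨S, hS, hS'⟩ : ∃! S, S ∈ SstarA Ab := existsUnique_mem_SstarB hn hSA
    obtain ⟨T, hT, hT'⟩ := existsUnique_mem_SstarB hm hSB
    exact ⟨(S, T), ⟨hS, hT⟩, fun x hx => Prod.ext (hS' _ hx.1) (hT' _ hx.2)⟩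
  · rintro (⟨hn, h⟩ | ⟨hm, h⟩)
    · exact (hAinf hn h).prod_left hB
    · exact (hBinf hm h).prod_right hA

end MultNoise
end

section
/- Suppose ℓ ≥ n + m and the pair (A, B) is controllable (i.e., [A^{n−1}B ⋯ AB B] has full row rank n). For any fixed μ₀ ∈ ℝ^n, define the sequence μ_{t+1} = A μ_t + B ν_t for t = 0,…,ℓ−1, and let Z ∈ ℝ^{(n+m)×ℓ} be the matrix whose t-th block column (from the right, t = 0,…,ℓ−1) is the stacked vector (μ_t; ν_t), i.e., Z = [[μ_{ℓ−1} ⋯ μ₀]; [ν_{ℓ−1} ⋯ ν₀]]. Then Z has full row rank n + m — and consequently Z Zᵀ is invertible — for Lebesgue-almost all (ν₀ᵀ, …, ν_{ℓ−1}ᵀ)ᵀ ∈ ℝ^{mℓ}. -/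
open MeasureTheory ProbabilityTheory Matrix Filter

namespace MultNoise

/-- Controllability matrix `[M^{d−1}N ⋯ MN N]`. -/
noncomputable def ctrb {d e : ℕ} (M : Matrix (Fin d) (Fin d) ℝ) (N : Matrix (Fin d) (Fin e) ℝ) :
    Matrix (Fin d) (Fin (d * e)) ℝ :=
  fun r c => (M ^ (d - 1 - c.val / e) * N) r ⟨c.val % e, Nat.mod_lt _ (pos_of_lt_mul c.isLt)⟩

/-- extend a finitely indexed input-mean sequence by zero. -/
def nuExt {m ℓ : ℕ} (ν : Fin ℓ → Fin m → ℝ) : ℕ → Fin m → ℝ :=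
  fun t => if h : t < ℓ then ν ⟨t, h⟩ else 0

/-- first-moment sequence `μ_{t+1} = A μ_t + B ν_t`. -/
noncomputable def muSeqD {n m ℓ : ℕ} (A : Matrix (Fin n) (Fin n) ℝ)
    (B : Matrix (Fin n) (Fin m) ℝ) (μ0 : Fin n → ℝ) (ν : Fin ℓ → Fin m → ℝ) :
    ℕ → Fin n → ℝ :=
  ldsTV (fun _ => A) (fun s => B.mulVec (nuExt ν s)) μ0

/-- The data matrix `Z = [[μ_{ℓ−1} ⋯ μ₀]; [ν_{ℓ−1} ⋯ ν₀]]`. -/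
noncomputable def ZmatD {n m ℓ : ℕ} (A : Matrix (Fin n) (Fin n) ℝ)
    (B : Matrix (Fin n) (Fin m) ℝ) (μ0 : Fin n → ℝ) (ν : Fin ℓ → Fin m → ℝ) :
    Matrix (Fin (n + m)) (Fin ℓ) ℝ :=
  fun r c =>
    if h : r.val < n then muSeqD A B μ0 ν (ℓ - 1 - c.val) ⟨r.val, h⟩
    else nuExt ν (ℓ - 1 - c.val) ⟨r.val - n, by have := r.isLt; omega⟩

/-- The zero set of a real-analytic function that does not vanish identically is null. -/
lemma ae_ne_zero_of_analytic {E : Type*} [NormedAddCommGroup E] [NormedSpace ℝ E]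
    [FiniteDimensional ℝ E] [MeasurableSpace E] [BorelSpace E] (μ : Measure E)
    [μ.IsAddHaarMeasure] {f : E → ℝ} (hf : ∀ x, AnalyticAt ℝ f x) {x₀ : E} (hx₀ : f x₀ ≠ 0) :
    ∀ᵐ x ∂μ, f x ≠ 0 := by
  have hcont : Continuous f := continuous_iff_continuousAt.2 fun x => (hf x).continuousAt
  have hline (v : E) : ∀ᵐ t : ℝ, f (x₀ + t • v) ≠ 0 := by
    have han : AnalyticOnNhd ℝ (fun t : ℝ => f (x₀ + t • v)) Set.univ := fun t _ =>
      (hf _).fun_comp (analyticAt_const.add (analyticAt_id.smul analyticAt_const))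
    have hmem := han.preimage_zero_mem_codiscrete (x := 0) (by simpa using hx₀)
    have hle := ae_restrict_le_codiscreteWithin (μ := (volume : Measure ℝ)) MeasurableSet.univ
    rw [Measure.restrict_univ] at hle
    filter_upwards [hle hmem] with t ht using ht
  have hmeas : MeasurableSet {p : E × ℝ | f (x₀ + p.2 • p.1) ≠ 0} :=
    (isOpen_ne_fun (by fun_prop) continuous_const).measurableSet
  have hswap := (Measure.ae_ae_comm (μ := μ) (ν := (volume : Measure ℝ)) hmeas).1
    (Eventually.of_forall hline)
  obtain ⟨t, ht, ht0⟩ := (hswap.and (Measure.ae_ne volume (0 : ℝ))).exists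
  rw [ae_iff] at ht ⊢
  have hpre : {v | ¬ f (x₀ + t • v) ≠ 0} =
      (t • ·) ⁻¹' ((fun v => x₀ + v) ⁻¹' {x | ¬ f x ≠ 0}) := rfl
  rw [hpre, Measure.addHaar_preimage_smul μ ht0, measure_preimage_add, mul_eq_zero] at ht
  refine ht.resolve_left ?_
  exact (ENNReal.ofReal_pos.2 (abs_pos.2 (inv_ne_zero (pow_ne_zero _ ht0)))).ne'

lemma ldsTV_congr {d : ℕ} (M : ℕ → Matrix (Fin d) (Fin d) ℝ) {g g' : ℕ → Fin d → ℝ}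
    (x0 : Fin d → ℝ) {t : ℕ} (h : ∀ s < t, g s = g' s) : ldsTV M g x0 t = ldsTV M g' x0 t := by
  induction t with
  | zero => rfl
  | succ t ih => simp only [ldsTV]; rw [ih fun s hs => h s (by omega), h t (by omega)]

/-- Controllability in dual form: no nonzero covector kills every `A ^ k * B`. -/
lemma eq_zero_of_vecMul_ctrb {n m : ℕ} {A : Matrix (Fin n) (Fin n) ℝ}
    {B : Matrix (Fin n) (Fin m) ℝ} (hctrb : (ctrb A B).rank = n) {z : Fin n → ℝ}
    (hz : ∀ k, z ᵥ* (A ^ k * B) = 0) : z = 0 := by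
  have hli : LinearIndependent ℝ (ctrb A B).row := by
    rw [linearIndependent_iff_card_eq_finrank_span, Set.finrank, ← Matrix.rank_eq_finrank_span_row, hctrb,
      Fintype.card_fin]
  refine Matrix.vecMul_injective_iff.2 hli ?_
  refine Eq.trans (funext fun c => ?_) (Matrix.zero_vecMul _).symm
  exact congrFun (hz _) _

/-- Inputs can be chosen one at a time so that the state-input pairs stay linearly independent. -/
lemma exists_linearIndependent_state_input {n m : ℕ} (A : Matrix (Fin n) (Fin n) ℝ)
    (B : Matrix (Fin n) (Fin m) ℝ) (hctrb : (ctrb A B).rank = n) (μ0 : Fin n → ℝ)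
    (t : ℕ) (ht : t ≤ n + m) :
    ∃ u : ℕ → Fin m → ℝ, LinearIndependent ℝ fun s : Fin t =>
      (ldsTV (fun _ => A) (fun s => B *ᵥ u s) μ0 s, u s) := by
  induction t with
  | zero => exact ⟨0, linearIndependent_empty_type⟩
  | succ t ih =>
    obtain ⟨u, hu⟩ := ih (by omega)
    set x := ldsTV (fun _ => A) (fun s => B *ᵥ u s) μ0 with hx
    set W := Submodule.span ℝ (Set.range fun s : Fin t => (x s, u s)) with hW
    obtain ⟨w, hw⟩ : ∃ w, (x t, w) ∉ W := by
      by_contra! hall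
      have hlt : W < ⊤ := by
        refine lt_top_iff_ne_top.2 fun h => ?_
        have h1 := finrank_span_eq_card hu
        rw [← hW, h, finrank_top] at h1
        simp at h1
        omega
      obtain ⟨φ, hφ, hφW⟩ := Submodule.exists_le_ker_of_lt_top W hlt
      have h0 (w : Fin m → ℝ) : (0, w) ∈ W := by
        simpa using W.sub_mem (hall w) (hall 0)
      have hφ2 (w : Fin m → ℝ) : φ (0, w) = 0 := hφW (h0 w)
      obtain ⟨z, hz⟩ : ∃ z : Fin n → ℝ, ∀ p, φ p = z ⬝ᵥ p.1 := by
        refine ⟨fun i => φ (Pi.single i 1, 0), fun p => ?_⟩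
        have h1 : φ p = φ (p.1, 0) + φ (0, p.2) := by simp [← map_add]
        rw [h1, hφ2, add_zero]
        have h2 := LinearMap.pi_apply_eq_sum_univ (φ ∘ₗ LinearMap.inl ℝ _ _) p.1
        simp only [LinearMap.comp_apply, LinearMap.inl_apply, smul_eq_mul] at h2
        rw [h2, dotProduct_comm]
        refine Finset.sum_congr rfl fun i _ => ?_
        have h3 : (fun j => if i = j then (1 : ℝ) else 0) = Pi.single i 1 := by
          ext j
          simp [Pi.single_apply, eq_comm]
        rw [h3]
      have hstep (y : Fin n → ℝ) (hy : ∀ p ∈ W, y ⬝ᵥ p.1 = 0) :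
          y ᵥ* B = 0 ∧ ∀ p ∈ W, (y ᵥ* A) ⬝ᵥ p.1 = 0 := by
        have hcol : ∀ p ∈ W, (y ᵥ* A) ⬝ᵥ p.1 + (y ᵥ* B) ⬝ᵥ p.2 = 0 := by
          intro p hp
          induction hp using Submodule.span_induction with
          | mem p hp =>
            obtain ⟨s, rfl⟩ := hp
            have hnext : y ⬝ᵥ x (s + 1) = 0 := by
              rcases (Nat.succ_le_of_lt s.2).lt_or_eq with h | h
              · exact hy _ (Submodule.subset_span ⟨⟨s + 1, h⟩, rfl⟩)
              · rw [show (s : ℕ) + 1 = t from h]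
                exact hy _ (hall 0)
            simpa [hx, ldsTV, dotProduct_add, dotProduct_mulVec] using hnext
          | zero => simp
          | add p q _ _ hp hq =>
            simp only [Prod.fst_add, Prod.snd_add, dotProduct_add]
            linarith
          | smul c p _ hp =>
            simp only [Prod.smul_fst, Prod.smul_snd, dotProduct_smul, ← smul_add, hp, smul_zero]
        have hB : y ᵥ* B = 0 := by
          refine dotProduct_eq_zero _ fun w => ?_
          simpa using hcol _ (h0 w)
        refine ⟨hB, fun p hp => ?_⟩
        simpa [hB] using hcol p hp
      have hpow (k : ℕ) : ∀ p ∈ W, (z ᵥ* A ^ k) ⬝ᵥ p.1 = 0 := by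
        induction k with
        | zero =>
          intro p hp
          simpa [hz] using hφW hp
        | succ k ih =>
          intro p hp
          rw [pow_succ, ← Matrix.vecMul_vecMul]
          exact (hstep _ ih).2 p hp
      have hz0 : z = 0 := eq_zero_of_vecMul_ctrb hctrb fun k => by
        rw [← Matrix.vecMul_vecMul]
        exact (hstep _ (hpow k)).1
      exact hφ (LinearMap.ext fun p => by simp [hz, hz0])
    refine ⟨Function.update u t w, ?_⟩
    have hstate (s : ℕ) (hs : s ≤ t) :
        ldsTV (fun _ => A) (fun s => B *ᵥ Function.update u t w s) μ0 s = x s :=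
      ldsTV_congr _ _ fun r hr => by rw [Function.update_of_ne (by omega)]
    have hfam : (fun s : Fin (t + 1) =>
        (ldsTV (fun _ => A) (fun s => B *ᵥ Function.update u t w s) μ0 s,
          Function.update u t w s)) =
        Fin.snoc (α := fun _ => (Fin n → ℝ) × (Fin m → ℝ)) (fun s : Fin t => (x s, u s))
          (x t, w) := by
      funext s
      refine Fin.lastCases ?_ (fun s => ?_) s
      · simp [hstate t le_rfl]
      · simp [hstate s s.2.le, Function.update_of_ne s.2.ne]
    rw [hfam]
    exact hu.finSnoc hw

lemma analyticAt_nuExt {m ℓ : ℕ} (t : ℕ) (j : Fin m) (ν : Fin ℓ → Fin m → ℝ) :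
    AnalyticAt ℝ (fun ν : Fin ℓ → Fin m → ℝ => nuExt ν t j) ν := by
  by_cases h : t < ℓ
  · simp only [nuExt, h, dite_true]
    exact ((ContinuousLinearMap.proj (R := ℝ) j).comp
      (ContinuousLinearMap.proj (R := ℝ) (φ := fun _ : Fin ℓ => Fin m → ℝ) ⟨t, h⟩)).analyticAt ν
  · simp only [nuExt, h, dite_false]
    exact analyticAt_const

lemma analyticAt_muSeqD {n m ℓ : ℕ} (A : Matrix (Fin n) (Fin n) ℝ)
    (B : Matrix (Fin n) (Fin m) ℝ) (μ0 : Fin n → ℝ) (t : ℕ) (i : Fin n)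
    (ν : Fin ℓ → Fin m → ℝ) : AnalyticAt ℝ (fun ν => muSeqD A B μ0 ν t i) ν := by
  induction t generalizing i with
  | zero => exact analyticAt_const
  | succ t ih =>
    simp only [muSeqD, ldsTV, Pi.add_apply, mulVec, dotProduct]
    refine AnalyticAt.add
      (Finset.analyticAt_fun_sum _ fun j _ => analyticAt_const.mul (ih j))
      (Finset.analyticAt_fun_sum _ fun j _ => analyticAt_const.mul (analyticAt_nuExt t j ν))

lemma analyticAt_ZmatD {n m ℓ : ℕ} (A : Matrix (Fin n) (Fin n) ℝ)
    (B : Matrix (Fin n) (Fin m) ℝ) (μ0 : Fin n → ℝ) (r : Fin (n + m)) (c : Fin ℓ)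
    (ν : Fin ℓ → Fin m → ℝ) : AnalyticAt ℝ (fun ν => ZmatD A B μ0 ν r c) ν := by
  by_cases h : r.val < n
  · simp only [ZmatD, h, dite_true]
    exact analyticAt_muSeqD ..
  · simp only [ZmatD, h, dite_false]
    exact analyticAt_nuExt ..

lemma analyticAt_det_ZmatD {n m ℓ : ℕ} (A : Matrix (Fin n) (Fin n) ℝ)
    (B : Matrix (Fin n) (Fin m) ℝ) (μ0 : Fin n → ℝ) (ν : Fin ℓ → Fin m → ℝ) :
    AnalyticAt ℝ (fun ν => (ZmatD A B μ0 ν * (ZmatD A B μ0 ν)ᵀ).det) ν := by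
  simp only [Matrix.det_apply', Matrix.mul_apply, Matrix.transpose_apply]
  exact Finset.analyticAt_fun_sum _ fun σ _ => analyticAt_const.mul
    (Finset.analyticAt_fun_prod _ fun i _ => Finset.analyticAt_fun_sum _ fun j _ =>
      (analyticAt_ZmatD ..).mul (analyticAt_ZmatD ..))

lemma exists_det_ZmatD_ne_zero {n m ℓ : ℕ} (A : Matrix (Fin n) (Fin n) ℝ)
    (B : Matrix (Fin n) (Fin m) ℝ) (hl : n + m ≤ ℓ) (hctrb : (ctrb A B).rank = n)
    (μ0 : Fin n → ℝ) :
    ∃ ν : Fin ℓ → Fin m → ℝ, (ZmatD A B μ0 ν * (ZmatD A B μ0 ν)ᵀ).det ≠ 0 := by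
  obtain ⟨u, hu⟩ := exists_linearIndependent_state_input A B hctrb μ0 (n + m) le_rfl
  refine ⟨fun s => u s, fun hdet => ?_⟩
  obtain ⟨z, hz0, hz⟩ := Matrix.exists_mulVec_eq_zero_iff.2 hdet
  set Z := ZmatD A B μ0 fun s : Fin ℓ => u s with hZ
  have hzZ : z ᵥ* Z = 0 := by
    rw [← Matrix.mulVec_mulVec, Matrix.mulVec_transpose] at hz
    rw [← dotProduct_self_eq_zero, ← Matrix.dotProduct_mulVec, hz, dotProduct_zero]
  let ψ : (Fin n → ℝ) × (Fin m → ℝ) →ₗ[ℝ] ℝ :=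
    (dotProductBilin ℝ ℝ fun i => z (Fin.castAdd m i)).coprod
      (dotProductBilin ℝ ℝ fun j => z (Fin.natAdd n j))
  have hψ : ψ = 0 := by
    refine LinearMap.ext_on_range
      (hu.span_eq_top_of_card_eq_finrank' (by simp)) fun s => ?_
    have hs : (s : ℕ) < ℓ := by omega
    have hcol := congrFun hzZ ⟨ℓ - 1 - s, by omega⟩
    have hidx : ℓ - 1 - (ℓ - 1 - (s : ℕ)) = s := by omega
    have hnu : nuExt (fun r : Fin ℓ => u r) s = u s := by simp [nuExt, hs]
    have hmu : muSeqD A B μ0 (fun r : Fin ℓ => u r) s =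
        ldsTV (fun _ => A) (fun s => B *ᵥ u s) μ0 s :=
      ldsTV_congr _ _ fun r hr => by simp [nuExt, hr.trans hs]
    simpa [ψ, Matrix.vecMul, dotProduct, Fin.sum_univ_add, hZ, ZmatD, hidx, hnu, hmu] using hcol
  refine hz0 (funext fun i => ?_)
  refine Fin.addCases (fun i => ?_) (fun j => ?_) i
  · simpa [ψ] using LinearMap.congr_fun hψ (Pi.single i 1, 0)
  · simpa [ψ] using LinearMap.congr_fun hψ (0, Pi.single j 1)

/-- Proposition 4 of the paper: if `ℓ ≥ n + m` and `(A,B)` is controllable,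
then for almost all input means `ν`, the data matrix `Z` has full row rank and `Z Zᵀ` is
invertible. -/
theorem statement3 {n m ℓ : ℕ} (hmn : m ≤ n)
    (A : Matrix (Fin n) (Fin n) ℝ) (B : Matrix (Fin n) (Fin m) ℝ)
    (hl : n + m ≤ ℓ) (hctrb : (ctrb A B).rank = n) (μ0 : Fin n → ℝ) :
    ∀ᵐ ν ∂(volume : Measure (Fin ℓ → Fin m → ℝ)),
      (ZmatD A B μ0 ν).rank = n + m ∧
      IsUnit (ZmatD A B μ0 ν * (ZmatD A B μ0 ν)ᵀ) := by
  obtain ⟨ν₀, hν₀⟩ := exists_det_ZmatD_ne_zero A B hl hctrb μ0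
  filter_upwards [ae_ne_zero_of_analytic volume (analyticAt_det_ZmatD A B μ0) hν₀] with ν hν
  have hunit : IsUnit (ZmatD A B μ0 ν * (ZmatD A B μ0 ν)ᵀ) :=
    (Matrix.isUnit_iff_isUnit_det _).2 (isUnit_iff_ne_zero.2 hν)
  refine ⟨?_, hunit⟩
  rw [← Matrix.rank_self_mul_transpose, Matrix.rank_of_isUnit _ hunit, Fintype.card_fin]

end MultNoise
end

section
/- Suppose ℓ ≥ [n(n+1) + m(m+1)]/2 and both (A, B) and (Ã + Σ̃_A', B̃ + Σ̃_B') are controllable pairs. For fixed μ₀ ∈ ℝ^n and X̃₀ ∈ ℝ^{n(n+1)/2}, with μ_t, X̃_t, W_t, W_t', Ũ_t generated by the deterministic recursions μ_{t+1} = Aμ_t + Bν_t, W_t = vec(μ_tν_tᵀ), W_t' = vec(ν_tμ_tᵀ), Ũ_t = P₂vec(Ū_t + ν_tν_tᵀ), X̃_{t+1} = (Ã + Σ̃_A')X̃_t + (B̃ + Σ̃_B')Ũ_t + K_{BA}W_t + K_{AB}W_t', both the matrices Z Zᵀ and D Dᵀ are invertible for Lebesgue-almost all (ν₀ᵀ,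 …, ν_{ℓ−1}ᵀ, svec(Ū₀)ᵀ, …, svec(Ū_{ℓ−1})ᵀ)ᵀ ∈ ℝ^{ℓ m(m+3)/2}, where Z = [[μ_{ℓ−1} ⋯ μ₀]; [ν_{ℓ−1} ⋯ ν₀]] and D = [[X̃_{ℓ−1} ⋯ X̃₀]; [Ũ_{ℓ−1} ⋯ Ũ₀]]. -/
open MeasureTheory ProbabilityTheory Matrix Filter

namespace MultNoise

/-- symmetric matricization of a half-vectorized symmetric matrix. -/
def smat (m : ℕ) (v : Fin (m * (m + 1) / 2) → ℝ) : Matrix (Fin m) (Fin m) ℝ :=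
  fun i j => if i ≤ j then v (tri m i j) else v (tri m j i)

/-- extend the input-covariance parameters (given via `svec` coordinates) by zero. -/
def UbarExt {m ℓ : ℕ} (w : Fin ℓ → Fin (m * (m + 1) / 2) → ℝ) :
    ℕ → Matrix (Fin m) (Fin m) ℝ :=
  fun t => if h : t < ℓ then smat m (w ⟨t, h⟩) else 0

/-- `Ũ_t = P₂ vec(Ū_t + ν_t ν_tᵀ)`. -/
noncomputable def UtilD {m ℓ : ℕ} (ν : Fin ℓ → Fin m → ℝ)
    (w : Fin ℓ → Fin (m * (m + 1) / 2) → ℝ) (t : ℕ) : Fin (m * (m + 1) / 2) → ℝ :=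
  (Pmat m).mulVec (vecM (UbarExt w t + Matrix.of fun i j => nuExt ν t i * nuExt ν t j))

/-- The second-moment sequence
`X̃_{t+1} = (Ã + Σ̃_A') X̃_t + (B̃ + Σ̃_B') Ũ_t + K_{BA} W_t + K_{AB} W_t'`. -/
noncomputable def XtilSeqD {n m ℓ : ℕ} (A : Matrix (Fin n) (Fin n) ℝ)
    (B : Matrix (Fin n) (Fin m) ℝ) (SigAp : Matrix (Fin (n * n)) (Fin (n * n)) ℝ)
    (SigBp : Matrix (Fin (n * n)) (Fin (m * m)) ℝ) (μ0 : Fin n → ℝ)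
    (X0 : Fin (n * (n + 1) / 2) → ℝ) (ν : Fin ℓ → Fin m → ℝ)
    (w : Fin ℓ → Fin (m * (m + 1) / 2) → ℝ) : ℕ → Fin (n * (n + 1) / 2) → ℝ :=
  ldsTV (fun _ => Pmat n * kron A A * Qmat n + Pmat n * SigAp * Qmat n)
    (fun t =>
      (Pmat n * kron B B * Qmat m + Pmat n * SigBp * Qmat m).mulVec (UtilD ν w t) +
      (Pmat n * kron B A).mulVec
        (vecM (Matrix.of fun (i : Fin n) (j : Fin m) => muSeqD A B μ0 ν t i * nuExt ν t j)) +
      (Pmat n * kron A B).mulVec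
        (vecM (Matrix.of fun (i : Fin m) (j : Fin n) => nuExt ν t i * muSeqD A B μ0 ν t j)))
    X0

/-- The data matrix `D = [[X̃_{ℓ−1} ⋯ X̃₀]; [Ũ_{ℓ−1} ⋯ Ũ₀]]`. -/
noncomputable def DmatD {n m ℓ : ℕ} (A : Matrix (Fin n) (Fin n) ℝ)
    (B : Matrix (Fin n) (Fin m) ℝ) (SigAp : Matrix (Fin (n * n)) (Fin (n * n)) ℝ)
    (SigBp : Matrix (Fin (n * n)) (Fin (m * m)) ℝ) (μ0 : Fin n → ℝ)
    (X0 : Fin (n * (n + 1) / 2) → ℝ) (ν : Fin ℓ → Fin m → ℝ)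
    (w : Fin ℓ → Fin (m * (m + 1) / 2) → ℝ) :
    Matrix (Fin (n * (n + 1) / 2 + m * (m + 1) / 2)) (Fin ℓ) ℝ :=
  fun r c =>
    if h : r.val < n * (n + 1) / 2 then
      XtilSeqD A B SigAp SigBp μ0 X0 ν w (ℓ - 1 - c.val) ⟨r.val, h⟩
    else UtilD ν w (ℓ - 1 - c.val) ⟨r.val - n * (n + 1) / 2, by have := r.isLt; omega⟩

/-- A real-analytic function that does not vanish identically is nonzero almost everywhere. -/
theorem ae_ne_zero_of_contDiff_omega {E : Type*} [NormedAddCommGroup E] [NormedSpace ℝ E]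
    [FiniteDimensional ℝ E] [MeasurableSpace E] [BorelSpace E] (μ : Measure E)
    [μ.IsAddHaarMeasure] {f : E → ℝ} (hf : ContDiff ℝ (⊤ : WithTop ℕ∞) f) {p : E}
    (hp : f p ≠ 0) : ∀ᵐ x ∂μ, f x ≠ 0 := by
  have hline : ∀ x : E, ∀ᵐ t : ℝ, f (p + t • (x - p)) ≠ 0 := by
    intro x
    have hg : ContDiff ℝ (⊤ : WithTop ℕ∞) (fun t : ℝ => f (p + t • (x - p))) :=
      hf.comp (contDiff_const.add (contDiff_id.smul contDiff_const))
    have h := (hg.analyticOnNhd (s := Set.univ)).preimage_zero_mem_codiscrete (x := 0)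
      (by simpa using hp)
    have h' := ae_restrict_le_codiscreteWithin (μ := (volume : Measure ℝ)) MeasurableSet.univ h
    rw [Measure.restrict_univ] at h'
    exact h'
  have hcont : Continuous fun q : ℝ × E => f (p + q.1 • (q.2 - p)) :=
    hf.continuous.comp (by fun_prop)
  have hmeas : MeasurableSet {q : E × ℝ | f (p + q.2 • (q.1 - p)) ≠ 0} :=
    ((isClosed_singleton (x := (0 : ℝ))).isOpen_compl.preimage
      (hcont.comp continuous_swap)).measurableSet
  have hswap : ∀ᵐ t : ℝ, ∀ᵐ x ∂μ, f (p + t • (x - p)) ≠ 0 :=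
    (Measure.ae_ae_comm hmeas).1 (Eventually.of_forall hline)
  obtain ⟨t, ht, ht0⟩ := (hswap.and (Measure.ae_ne volume (0 : ℝ))).exists
  have hsub : ∀ᵐ x ∂μ, f (p + t • x) ≠ 0 := by
    rw [ae_iff] at ht ⊢
    rw [← measure_preimage_add_right μ (-p)]
    simpa [← sub_eq_add_neg] using ht
  have hsmul : ∀ᵐ x ∂μ, f (p + x) ≠ 0 := by
    rw [ae_iff] at hsub ⊢
    have h := Measure.addHaar_preimage_smul μ ht0 {x : E | ¬ f (p + x) ≠ 0}
    have h0 : μ ((t • ·) ⁻¹' {x : E | ¬ f (p + x) ≠ 0}) = 0 := hsub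
    rw [h0] at h
    simpa [ht0] using h.symm
  rw [ae_iff] at hsmul ⊢
  rw [← measure_preimage_add μ p]
  exact hsmul

/-- An invariant subspace containing the input directions of a controllable pair is everything. -/
lemma eq_top_of_ctrb_rank {d e : ℕ} {M : Matrix (Fin d) (Fin d) ℝ} {N : Matrix (Fin d) (Fin e) ℝ}
    (h : (ctrb M N).rank = d) {X : Submodule ℝ (Fin d → ℝ)} (hM : ∀ x ∈ X, M *ᵥ x ∈ X)
    (hN : ∀ u, N *ᵥ u ∈ X) : X = ⊤ := by
  have hpow : ∀ k u, (M ^ k * N) *ᵥ u ∈ X := by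
    intro k u
    induction k with
    | zero => simpa using hN u
    | succ k ih =>
      rw [pow_succ', Matrix.mul_assoc, ← mulVec_mulVec]
      exact hM _ ih
  have htop : LinearMap.range (ctrb M N).mulVecLin = ⊤ :=
    Submodule.eq_top_of_finrank_eq (by simpa [Matrix.rank] using h)
  rw [eq_top_iff, ← htop, Matrix.range_mulVecLin, Submodule.span_le]
  rintro _ ⟨c, rfl⟩
  have := hpow (d - 1 - c.val / e) (Pi.single ⟨c.val % e, Nat.mod_lt _ (pos_of_lt_mul c.isLt)⟩ 1)
  rwa [mulVec_single_one] at this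

/-- The span of the state-input pairs of a linear system over the first `k` time steps. -/
def pairSpan {d e : ℕ} (M : Matrix (Fin d) (Fin d) ℝ) (N : Matrix (Fin d) (Fin e) ℝ)
    (x0 : Fin d → ℝ) (u : ℕ → Fin e → ℝ) (k : ℕ) : Submodule ℝ ((Fin d → ℝ) × (Fin e → ℝ)) :=
  Submodule.span ℝ
    ((fun t => (ldsTV (fun _ => M) (fun s => N *ᵥ u s) x0 t, u t)) '' {t | t < k})

/-- As long as the collected state-input pairs of a controllable system do not span, some next
input produces a pair outside their span. -/
lemma exists_pair_notMem {d e : ℕ} {M : Matrix (Fin d) (Fin d) ℝ} {N : Matrix (Fin d) (Fin e) ℝ}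
    (h : (ctrb M N).rank = d) (x0 : Fin d → ℝ) (u : ℕ → Fin e → ℝ) (k : ℕ)
    (hk : pairSpan M N x0 u k ≠ ⊤) :
    ∃ v, (ldsTV (fun _ => M) (fun s => N *ᵥ u s) x0 k, v) ∉ pairSpan M N x0 u k := by
  set x := ldsTV (fun _ => M) (fun s => N *ᵥ u s) x0 with hx
  by_contra! hall
  apply hk
  have hin : ∀ v, ((0 : Fin d → ℝ), v) ∈ pairSpan M N x0 u k := fun v => by
    simpa using Submodule.sub_mem _ (hall v) (hall 0)
  set X := (pairSpan M N x0 u k).map (LinearMap.fst ℝ (Fin d → ℝ) (Fin e → ℝ)) with hX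
  have hpair : ∀ y ∈ X, ∀ v, (y, v) ∈ pairSpan M N x0 u k := by
    rintro _ ⟨⟨y, w⟩, hy, rfl⟩ v
    simpa using Submodule.add_mem _ hy (hin (v - w))
  have hxX : ∀ t ≤ k, x t ∈ X := by
    intro t ht
    rcases ht.lt_or_eq with ht | rfl
    · exact ⟨(x t, u t), Submodule.subset_span ⟨t, ht, rfl⟩, rfl⟩
    · exact ⟨(x t, 0), hall 0, rfl⟩
  have hstep : pairSpan M N x0 u k ≤ X.comap (M.mulVecLin.coprod N.mulVecLin) := by
    refine Submodule.span_le.2 ?_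
    rintro _ ⟨t, ht, rfl⟩
    exact hxX (t + 1) ht
  have htop : X = ⊤ := by
    refine eq_top_of_ctrb_rank h (fun y hy => ?_) fun v => ?_
    · simpa using hstep (hpair y hy 0)
    · simpa using hstep (hin v)
  refine eq_top_iff.2 fun z _ => hpair z.1 (by simp [htop]) z.2

/-- A controllable system admits inputs whose first `d + e` state-input pairs span. -/
lemma exists_pairSpan_eq_top {d e : ℕ} {M : Matrix (Fin d) (Fin d) ℝ}
    {N : Matrix (Fin d) (Fin e) ℝ} (h : (ctrb M N).rank = d) (x0 : Fin d → ℝ) :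
    ∃ u, pairSpan M N x0 u (d + e) = ⊤ := by
  have key : ∀ k ≤ d + e, ∃ u, k ≤ Module.finrank ℝ (pairSpan M N x0 u k) := by
    intro k hk
    induction k with
    | zero => exact ⟨0, Nat.zero_le _⟩
    | succ k ih =>
      obtain ⟨u, hu⟩ := ih (by omega)
      have hv : ∃ v, pairSpan M N x0 u k = ⊤ ∨
          (ldsTV (fun _ => M) (fun s => N *ᵥ u s) x0 k, v) ∉ pairSpan M N x0 u k := by
        by_cases htop : pairSpan M N x0 u k = ⊤
        · exact ⟨0, Or.inl htop⟩
        · exact (exists_pair_notMem h x0 u k htop).imp fun _ => Or.inr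
      obtain ⟨v, hv⟩ := hv
      refine ⟨Function.update u k v, ?_⟩
      have hu' : ∀ s < k, Function.update u k v s = u s := fun s hs =>
        Function.update_of_ne hs.ne _ _
      have hx : ∀ t ≤ k, ldsTV (fun _ => M) (fun s => N *ᵥ Function.update u k v s) x0 t =
          ldsTV (fun _ => M) (fun s => N *ᵥ u s) x0 t := fun t ht =>
        ldsTV_congr _ _ fun s hs => by rw [hu' s (by omega)]
      have hle : pairSpan M N x0 u k ≤ pairSpan M N x0 (Function.update u k v) (k + 1) := by
        refine Submodule.span_le.2 ?_
        rintro _ ⟨t, ht, rfl⟩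
        have ht : t < k := ht
        refine Submodule.subset_span ⟨t, Nat.lt_succ_of_lt ht, ?_⟩
        simp only [hx t ht.le, hu' t ht]
      rcases hv with htop | hv
      · rw [htop, top_le_iff] at hle
        rw [hle]
        simpa using hk
      · have hmem : (ldsTV (fun _ => M) (fun s => N *ᵥ u s) x0 k, v) ∈
            pairSpan M N x0 (Function.update u k v) (k + 1) :=
          Submodule.subset_span ⟨k, Nat.lt_succ_self k, by simp [hx k le_rfl]⟩
        have hlt := Submodule.finrank_lt_finrank_of_lt
          (lt_of_le_of_ne hle fun heq => hv (heq ▸ hmem))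
        omega
  obtain ⟨u, hu⟩ := key (d + e) le_rfl
  refine ⟨u, Submodule.eq_top_of_finrank_eq (le_antisymm (Submodule.finrank_le _) ?_)⟩
  simpa using hu

/-- The matrix whose columns are the state-input pairs, latest first. -/
def dataMat {d e : ℕ} (ℓ : ℕ) (x : ℕ → Fin d → ℝ) (u : ℕ → Fin e → ℝ) :
    Matrix (Fin (d + e)) (Fin ℓ) ℝ :=
  fun r c => Fin.append (x (ℓ - 1 - c.val)) (u (ℓ - 1 - c.val)) r

lemma det_dataMat_ne_zero {d e ℓ : ℕ} {M : Matrix (Fin d) (Fin d) ℝ}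
    {N : Matrix (Fin d) (Fin e) ℝ} {x0 : Fin d → ℝ} {x : ℕ → Fin d → ℝ} {u : ℕ → Fin e → ℝ}
    (hx : ∀ t < ℓ, x t = ldsTV (fun _ => M) (fun s => N *ᵥ u s) x0 t)
    (hl : d + e ≤ ℓ) (h : pairSpan M N x0 u (d + e) = ⊤) :
    (dataMat ℓ x u * (dataMat ℓ x u)ᵀ).det ≠ 0 := by
  refine fun hdet => ?_
  obtain ⟨v, hv0, hv⟩ := exists_mulVec_eq_zero_iff.2 hdet
  apply hv0
  have hv' : (dataMat ℓ x u)ᵀ *ᵥ v = 0 := by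
    rw [← conjTranspose_eq_transpose_of_trivial] at hv ⊢
    exact (self_mul_conjTranspose_mulVec_eq_zero _ _).1 hv
  let φ : (Fin d → ℝ) × (Fin e → ℝ) →ₗ[ℝ] ℝ :=
    (dotProductBilin ℝ ℝ (fun i => v (Fin.castAdd e i))).coprod
      (dotProductBilin ℝ ℝ (fun i => v (Fin.natAdd d i)))
  have hφ : ∀ y, φ y = ∑ i, v (Fin.castAdd e i) * y.1 i + ∑ i, v (Fin.natAdd d i) * y.2 i :=
    fun y => rfl
  have hker : ∀ y, φ y = 0 := by
    intro y
    have hy : y ∈ pairSpan M N x0 u (d + e) := by simp [h]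
    suffices pairSpan M N x0 u (d + e) ≤ LinearMap.ker φ from this hy
    refine Submodule.span_le.2 ?_
    rintro _ ⟨t, ht, rfl⟩
    have htl : t < ℓ := lt_of_lt_of_le ht hl
    have hc := congrFun hv' ⟨ℓ - 1 - t, by omega⟩
    have htt : ℓ - 1 - (ℓ - 1 - t) = t := by omega
    simp only [mulVec, dotProduct, transpose_apply, dataMat, htt, Fin.sum_univ_add,
      Fin.append_left, Fin.append_right, Pi.zero_apply] at hc
    rw [SetLike.mem_coe, LinearMap.mem_ker, hφ, ← hc, hx t htl]
    simp only [mul_comm]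
  funext r
  refine Fin.addCases (fun i => ?_) (fun i => ?_) r
  · simpa [hφ, Pi.single_apply] using hker (Pi.single i 1, 0)
  · simpa [hφ, Pi.single_apply] using hker (0, Pi.single i 1)

lemma contDiff_mulVec {E : Type*} [NormedAddCommGroup E] [NormedSpace ℝ E] {a b : ℕ}
    {k : WithTop ℕ∞} (M : Matrix (Fin a) (Fin b) ℝ) {f : E → Fin b → ℝ} (hf : ContDiff ℝ k f) :
    ContDiff ℝ k fun p => M *ᵥ f p :=
  (LinearMap.toContinuousLinearMap M.mulVecLin).contDiff.comp hf

lemma contDiff_det_dataMat {E : Type*} [NormedAddCommGroup E] [NormedSpace ℝ E] {d e ℓ : ℕ}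
    {k : WithTop ℕ∞} {x : E → ℕ → Fin d → ℝ} {u : E → ℕ → Fin e → ℝ}
    (hx : ∀ t, ContDiff ℝ k fun p => x p t) (hu : ∀ t, ContDiff ℝ k fun p => u p t) :
    ContDiff ℝ k fun p => (dataMat ℓ (x p) (u p) * (dataMat ℓ (x p) (u p))ᵀ).det := by
  have hentry : ∀ r c, ContDiff ℝ k fun p => dataMat ℓ (x p) (u p) r c := by
    intro r c
    refine Fin.addCases (fun i => ?_) (fun i => ?_) r
    · simpa [dataMat] using contDiff_pi.1 (hx (ℓ - 1 - c.val)) i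
    · simpa [dataMat] using contDiff_pi.1 (hu (ℓ - 1 - c.val)) i
  simp only [det_apply', mul_apply, transpose_apply]
  exact ContDiff.sum fun σ _ => contDiff_const.mul <| contDiff_prod fun i _ =>
    ContDiff.sum fun j _ => (hentry _ _).mul (hentry _ _)

lemma contDiff_ldsTV {E : Type*} [NormedAddCommGroup E] [NormedSpace ℝ E] {d : ℕ}
    {k : WithTop ℕ∞} (M : ℕ → Matrix (Fin d) (Fin d) ℝ) {g : E → ℕ → Fin d → ℝ}
    (x0 : Fin d → ℝ) (hg : ∀ t, ContDiff ℝ k fun p => g p t) (t : ℕ) :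
    ContDiff ℝ k fun p => ldsTV M (g p) x0 t := by
  induction t with
  | zero => exact contDiff_const
  | succ t ih => exact (contDiff_mulVec _ ih).add (hg t)

lemma isUnit_of_ae_dataMat {E : Type*} [NormedAddCommGroup E] [NormedSpace ℝ E]
    [FiniteDimensional ℝ E] [MeasurableSpace E] [BorelSpace E] (μ : Measure E)
    [μ.IsAddHaarMeasure] {d e ℓ : ℕ} {M : Matrix (Fin d) (Fin d) ℝ}
    {N : Matrix (Fin d) (Fin e) ℝ} (h : (ctrb M N).rank = d) (hl : d + e ≤ ℓ) (x0 : Fin d → ℝ)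
    {x : E → ℕ → Fin d → ℝ} {u : E → ℕ → Fin e → ℝ}
    (hx : ∀ t, ContDiff ℝ (⊤ : WithTop ℕ∞) fun p => x p t)
    (hu : ∀ t, ContDiff ℝ (⊤ : WithTop ℕ∞) fun p => u p t)
    (hsurj : ∀ v : ℕ → Fin e → ℝ, ∃ p, ∀ t < ℓ, u p t = v t ∧
      x p t = ldsTV (fun _ => M) (fun s => N *ᵥ v s) x0 t) :
    ∀ᵐ p ∂μ, IsUnit (dataMat ℓ (x p) (u p) * (dataMat ℓ (x p) (u p))ᵀ) := by
  obtain ⟨v, hv⟩ := exists_pairSpan_eq_top h x0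
  obtain ⟨p, hp⟩ := hsurj v
  have hdata : dataMat ℓ (x p) (u p) = dataMat ℓ (x p) v := by
    ext r c
    simp only [dataMat]
    rw [(hp (ℓ - 1 - c.val) (by have := c.isLt; omega)).1]
  have hne : (dataMat ℓ (x p) (u p) * (dataMat ℓ (x p) (u p))ᵀ).det ≠ 0 := by
    rw [hdata]
    exact det_dataMat_ne_zero (fun t ht => (hp t ht).2) hl hv
  filter_upwards [ae_ne_zero_of_contDiff_omega μ (contDiff_det_dataMat hx hu) hne] with q hq
  exact (isUnit_iff_isUnit_det _).2 hq.isUnit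

/-- The position of the diagonal entry in row `i` of the half-vectorization enumeration. -/
def triStart (n i : ℕ) : ℕ := i * n + i - i * (i + 1) / 2

lemma triStart_succ {n i : ℕ} (hi : i < n) : triStart n (i + 1) = triStart n i + (n - i) := by
  obtain ⟨k, hk⟩ := Nat.even_mul_succ_self i
  have h1 : (i + 1) * (i + 1 + 1) = k + k + 2 * (i + 1) := by rw [← hk]; ring
  have h2 : (i + 1) * n = i * n + n := by ring
  have h3 : k ≤ i * n + i := by nlinarith
  unfold triStart
  omega

lemma triStart_mono {n i j : ℕ} (hij : i ≤ j) (hj : j ≤ n) : triStart n i ≤ triStart n j := by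
  induction j, hij using Nat.le_induction with
  | base => rfl
  | succ j _ ih =>
    rw [triStart_succ (by omega)]
    exact (ih (by omega)).trans (Nat.le_add_right _ _)

lemma tri_val {n : ℕ} {i j : Fin n} (hij : i ≤ j) :
    (tri n i j).val = triStart n i + (j.val - i.val) := by
  obtain ⟨k, hk⟩ := Nat.even_mul_succ_self i.val
  have h3 : k ≤ i.val * n + i.val := by nlinarith [i.isLt]
  have : i.val ≤ j.val := hij
  simp only [tri, triStart]
  omega

lemma tri_injOn {n : ℕ} {i j i' j' : Fin n} (hij : i ≤ j) (hij' : i' ≤ j')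
    (h : tri n i j = tri n i' j') : i = i' ∧ j = j' := by
  have hv := congrArg Fin.val h
  rw [tri_val hij, tri_val hij'] at hv
  have h1 : i.val ≤ j.val := hij
  have h2 : i'.val ≤ j'.val := hij'
  have key : ∀ {a b : Fin n}, a.val < b.val → triStart n a + (n - a) ≤ triStart n b :=
    fun {a b} hab => by
      rw [← triStart_succ a.isLt]
      exact triStart_mono hab b.isLt.le
  have hi : i = i' := by
    apply Fin.ext
    rcases lt_trichotomy i.val i'.val with hlt | heq | hlt
    · have := key hlt
      omega
    · exact heq
    · have := key hlt
      omega
  subst hi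
  exact ⟨rfl, Fin.ext (by omega)⟩

lemma exists_tri_eq {n : ℕ} (k : Fin (n * (n + 1) / 2)) : ∃ i j : Fin n, i ≤ j ∧ tri n i j = k := by
  have key : ∀ b ≤ n, k.val < triStart n b →
      ∃ i < b, triStart n i ≤ k.val ∧ k.val < triStart n (i + 1) := by
    intro b hb hk
    induction b with
    | zero => simp [triStart] at hk
    | succ b ih =>
      by_cases h : k.val < triStart n b
      · obtain ⟨i, hi, hi'⟩ := ih (by omega) h
        exact ⟨i, by omega, hi'⟩
      · exact ⟨b, by omega, by omega, hk⟩
  have hn : triStart n n = n * (n + 1) / 2 := by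
    obtain ⟨l, hl⟩ := Nat.even_mul_succ_self n
    have : n * n + n = l + l := by rw [← hl]; ring
    unfold triStart
    omega
  obtain ⟨i, hi, h1, h2⟩ := key n le_rfl (by rw [hn]; exact k.isLt)
  rw [triStart_succ hi] at h2
  have hij : (⟨i, hi⟩ : Fin n) ≤ ⟨k.val - triStart n i + i, by omega⟩ := by
    simp [Fin.le_def]
  refine ⟨_, _, hij, Fin.ext ?_⟩
  rw [tri_val hij]
  simp only
  omega

lemma Pmat_mulVec_tri {n : ℕ} (v : Fin (n * n) → ℝ) {i j : Fin n} (hij : i ≤ j) :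
    (Pmat n *ᵥ v) (tri n i j) = v (idx2 i j) := by
  have h : ∀ c, (∃ i' j' : Fin n, i' ≤ j' ∧ tri n i j = tri n i' j' ∧ c = idx2 i' j') ↔
      c = idx2 i j := by
    refine fun c => ⟨?_, fun hc => ⟨i, j, hij, rfl, hc⟩⟩
    rintro ⟨i', j', hij', ht, rfl⟩
    obtain ⟨rfl, rfl⟩ := tri_injOn hij hij' ht
    rfl
  simp [mulVec, dotProduct, Pmat, h]

lemma vecM_idx2 {a b : ℕ} (M : Matrix (Fin a) (Fin b) ℝ) (i : Fin b) (j : Fin a) :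
    vecM M (idx2 i j) = M j i := by
  have ha : 0 < a := j.pos
  simp only [vecM, idx2]
  have h1 : (i.val * a + j.val) % a = j := by simp [Nat.mod_eq_of_lt j.isLt]
  have h2 : (i.val * a + j.val) / a = i := by
    rw [mul_comm, Nat.mul_add_div ha, Nat.div_eq_of_lt j.isLt, add_zero]
  simp only [h1, h2]

lemma Pmat_mulVec_vecM_smat {m : ℕ} (w : Fin (m * (m + 1) / 2) → ℝ) :
    Pmat m *ᵥ vecM (smat m w) = w := by
  funext k
  obtain ⟨i, j, hij, rfl⟩ := exists_tri_eq k
  rw [Pmat_mulVec_tri _ hij, vecM_idx2, smat]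
  split_ifs with hji
  · rw [le_antisymm hij hji]
  · rfl

lemma contDiff_vecM {E : Type*} [NormedAddCommGroup E] [NormedSpace ℝ E] {a b : ℕ}
    {k : WithTop ℕ∞} {F : E → Matrix (Fin a) (Fin b) ℝ}
    (hF : ∀ i j, ContDiff ℝ k fun p => F p i j) : ContDiff ℝ k fun p => vecM (F p) :=
  contDiff_pi.2 fun _ => hF _ _

section Smoothness

variable {m ℓ : ℕ} {E : Type*} [NormedAddCommGroup E] [NormedSpace ℝ E] {k : WithTop ℕ∞}
  {ν : E → Fin ℓ → Fin m → ℝ} {w : E → Fin ℓ → Fin (m * (m + 1) / 2) → ℝ}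

lemma contDiff_nuExt (hν : ContDiff ℝ k ν) (t : ℕ) : ContDiff ℝ k fun p => nuExt (ν p) t := by
  by_cases h : t < ℓ
  · simpa [nuExt, h] using contDiff_pi.1 hν ⟨t, h⟩
  · simpa [nuExt, h] using contDiff_const

lemma contDiff_UbarExt (hw : ContDiff ℝ k w) (t : ℕ) (i j : Fin m) :
    ContDiff ℝ k fun p => UbarExt (w p) t i j := by
  by_cases h : t < ℓ
  · have hw' := contDiff_pi.1 (contDiff_pi.1 hw ⟨t, h⟩)
    by_cases hij : i ≤ j
    · simpa [UbarExt, h, smat, hij] using hw' (tri m i j)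
    · simpa [UbarExt, h, smat, hij] using hw' (tri m j i)
  · simpa [UbarExt, h] using contDiff_const

lemma contDiff_UtilD (hν : ContDiff ℝ k ν) (hw : ContDiff ℝ k w) (t : ℕ) :
    ContDiff ℝ k fun p => UtilD (ν p) (w p) t := by
  have hν' := contDiff_pi.1 (contDiff_nuExt hν t)
  exact contDiff_mulVec _ <| contDiff_vecM fun i j =>
    (contDiff_UbarExt hw t i j).add ((hν' i).mul (hν' j))

lemma contDiff_muSeqD {n : ℕ} (A : Matrix (Fin n) (Fin n) ℝ) (B : Matrix (Fin n) (Fin m) ℝ)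
    (μ0 : Fin n → ℝ) (hν : ContDiff ℝ k ν) (t : ℕ) :
    ContDiff ℝ k fun p => muSeqD A B μ0 (ν p) t :=
  contDiff_ldsTV _ _ (fun s => contDiff_mulVec _ (contDiff_nuExt hν s)) t

lemma contDiff_XtilSeqD {n : ℕ} (A : Matrix (Fin n) (Fin n) ℝ) (B : Matrix (Fin n) (Fin m) ℝ)
    (SigAp : Matrix (Fin (n * n)) (Fin (n * n)) ℝ) (SigBp : Matrix (Fin (n * n)) (Fin (m * m)) ℝ)
    (μ0 : Fin n → ℝ) (X0 : Fin (n * (n + 1) / 2) → ℝ) (hν : ContDiff ℝ k ν)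
    (hw : ContDiff ℝ k w) (t : ℕ) :
    ContDiff ℝ k fun p => XtilSeqD A B SigAp SigBp μ0 X0 (ν p) (w p) t := by
  have hν' := fun s => contDiff_pi.1 (contDiff_nuExt hν s)
  have hμ := fun s => contDiff_pi.1 (contDiff_muSeqD A B μ0 hν s)
  refine contDiff_ldsTV _ _ (fun s => ?_) t
  exact ((contDiff_mulVec _ (contDiff_UtilD hν hw s)).add
    (contDiff_mulVec _ (contDiff_vecM fun i j => (hμ s i).mul (hν' s j)))).add
    (contDiff_mulVec _ (contDiff_vecM fun i j => (hν' s i).mul (hμ s j)))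

end Smoothness

lemma UtilD_zero {m ℓ : ℕ} (w : Fin ℓ → Fin (m * (m + 1) / 2) → ℝ) {t : ℕ} (ht : t < ℓ) :
    UtilD 0 w t = w ⟨t, ht⟩ := by
  have h : UbarExt w t + (Matrix.of fun i j => nuExt (0 : Fin ℓ → Fin m → ℝ) t i *
      nuExt (0 : Fin ℓ → Fin m → ℝ) t j) =
      smat m (w ⟨t, ht⟩) := by
    ext i j
    simp [UbarExt, nuExt, ht]
  rw [UtilD, h, Pmat_mulVec_vecM_smat]

lemma XtilSeqD_zero {n m ℓ : ℕ} (A : Matrix (Fin n) (Fin n) ℝ) (B : Matrix (Fin n) (Fin m) ℝ)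
    (SigAp : Matrix (Fin (n * n)) (Fin (n * n)) ℝ) (SigBp : Matrix (Fin (n * n)) (Fin (m * m)) ℝ)
    (μ0 : Fin n → ℝ) (X0 : Fin (n * (n + 1) / 2) → ℝ)
    (w : Fin ℓ → Fin (m * (m + 1) / 2) → ℝ) (t : ℕ) :
    XtilSeqD A B SigAp SigBp μ0 X0 0 w t =
      ldsTV (fun _ => Pmat n * kron A A * Qmat n + Pmat n * SigAp * Qmat n)
        (fun s => (Pmat n * kron B B * Qmat m + Pmat n * SigBp * Qmat m) *ᵥ UtilD 0 w s) X0 t := by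
  refine ldsTV_congr _ _ fun s _ => ?_
  have hν : nuExt (0 : Fin ℓ → Fin m → ℝ) s = 0 := by
    unfold nuExt
    split_ifs <;> rfl
  have h1 : vecM (Matrix.of fun (i : Fin n) (j : Fin m) =>
      muSeqD A B μ0 (0 : Fin ℓ → Fin m → ℝ) s i * nuExt (0 : Fin ℓ → Fin m → ℝ) s j) = 0 := by
    funext c
    simp [vecM, hν]
  have h2 : vecM (Matrix.of fun (i : Fin m) (j : Fin n) =>
      nuExt (0 : Fin ℓ → Fin m → ℝ) s i * muSeqD A B μ0 (0 : Fin ℓ → Fin m → ℝ) s j) = 0 := by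
    funext c
    simp [vecM, hν]
  simp only [h1, h2, mulVec_zero, add_zero]

lemma ZmatD_eq_dataMat {n m ℓ : ℕ} (A : Matrix (Fin n) (Fin n) ℝ) (B : Matrix (Fin n) (Fin m) ℝ)
    (μ0 : Fin n → ℝ) (ν : Fin ℓ → Fin m → ℝ) :
    ZmatD A B μ0 ν = dataMat ℓ (muSeqD A B μ0 ν) (nuExt ν) := by
  ext r c
  refine Fin.addCases (fun i => ?_) (fun i => ?_) r <;> simp [ZmatD, dataMat]

lemma DmatD_eq_dataMat {n m ℓ : ℕ} (A : Matrix (Fin n) (Fin n) ℝ) (B : Matrix (Fin n) (Fin m) ℝ)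
    (SigAp : Matrix (Fin (n * n)) (Fin (n * n)) ℝ) (SigBp : Matrix (Fin (n * n)) (Fin (m * m)) ℝ)
    (μ0 : Fin n → ℝ) (X0 : Fin (n * (n + 1) / 2) → ℝ) (ν : Fin ℓ → Fin m → ℝ)
    (w : Fin ℓ → Fin (m * (m + 1) / 2) → ℝ) :
    DmatD A B SigAp SigBp μ0 X0 ν w =
      dataMat ℓ (XtilSeqD A B SigAp SigBp μ0 X0 ν w) (UtilD ν w) := by
  ext r c
  refine Fin.addCases (fun i => ?_) (fun i => ?_) r <;> simp [DmatD, dataMat]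

/-- Corollary 6 of the paper: if `ℓ ≥ [n(n+1)+m(m+1)]/2` and both `(A,B)`
and `(Ã + Σ̃_A', B̃ + Σ̃_B')` are controllable, then for Lebesgue-almost all input means and
input covariances both `Z Zᵀ` and `D Dᵀ` are invertible. -/
theorem statement5 {n m ℓ : ℕ} (hmn : m ≤ n)
    (A : Matrix (Fin n) (Fin n) ℝ) (B : Matrix (Fin n) (Fin m) ℝ)
    (SigAp : Matrix (Fin (n * n)) (Fin (n * n)) ℝ)
    (SigBp : Matrix (Fin (n * n)) (Fin (m * m)) ℝ)
    (hl : (n * (n + 1) + m * (m + 1)) / 2 ≤ ℓ)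
    (hctrbAB : (ctrb A B).rank = n)
    (hctrb2 : (ctrb (Pmat n * kron A A * Qmat n + Pmat n * SigAp * Qmat n)
        (Pmat n * kron B B * Qmat m + Pmat n * SigBp * Qmat m)).rank = n * (n + 1) / 2)
    (μ0 : Fin n → ℝ) (X0 : Fin (n * (n + 1) / 2) → ℝ) :
    ∀ᵐ ρ ∂(volume :
        Measure ((Fin ℓ → Fin m → ℝ) × (Fin ℓ → Fin (m * (m + 1) / 2) → ℝ))),
      IsUnit (ZmatD A B μ0 ρ.1 * (ZmatD A B μ0 ρ.1)ᵀ) ∧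
      IsUnit (DmatD A B SigAp SigBp μ0 X0 ρ.1 ρ.2 *
        (DmatD A B SigAp SigBp μ0 X0 ρ.1 ρ.2)ᵀ) := by
  have hpi : ∀ k : ℕ, (volume : Measure (Fin ℓ → Fin k → ℝ)).IsAddHaarMeasure := fun k =>
    Measure.pi.isAddHaarMeasure fun _ => (volume : Measure (Fin k → ℝ))
  have := hpi m
  have := hpi (m * (m + 1) / 2)
  have : (volume : Measure ((Fin ℓ → Fin m → ℝ) ×
      (Fin ℓ → Fin (m * (m + 1) / 2) → ℝ))).IsAddHaarMeasure :=
    Measure.prod.instIsAddHaarMeasure _ _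
  obtain ⟨a, ha⟩ := Nat.even_mul_succ_self n
  obtain ⟨b, hb⟩ := Nat.even_mul_succ_self m
  have hl2 : n * (n + 1) / 2 + m * (m + 1) / 2 ≤ ℓ := by omega
  have hl1 : n + m ≤ ℓ := by
    have h1 : n ≤ n * n := Nat.le_mul_self n
    have h2 : m ≤ m * m := Nat.le_mul_self m
    have h3 : n * (n + 1) = n * n + n := by ring
    have h4 : m * (m + 1) = m * m + m := by ring
    omega
  have hZ := isUnit_of_ae_dataMat (volume : Measure ((Fin ℓ → Fin m → ℝ) ×
      (Fin ℓ → Fin (m * (m + 1) / 2) → ℝ))) hctrbAB hl1 μ0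
    (x := fun ρ => muSeqD A B μ0 ρ.1) (u := fun ρ => nuExt ρ.1)
    (contDiff_muSeqD A B μ0 contDiff_fst) (contDiff_nuExt contDiff_fst) fun v => by
      have hv : ∀ t < ℓ, nuExt (fun s : Fin ℓ => v s) t = v t := fun t ht => by simp [nuExt, ht]
      refine ⟨(fun s => v s, 0), fun t ht => ⟨hv t ht, ldsTV_congr _ _ fun s hs => ?_⟩⟩
      simp only [hv s (hs.trans ht)]
  have hD := isUnit_of_ae_dataMat (volume : Measure ((Fin ℓ → Fin m → ℝ) ×
      (Fin ℓ → Fin (m * (m + 1) / 2) → ℝ))) hctrb2 hl2 X0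
    (x := fun ρ => XtilSeqD A B SigAp SigBp μ0 X0 ρ.1 ρ.2) (u := fun ρ => UtilD ρ.1 ρ.2)
    (contDiff_XtilSeqD A B SigAp SigBp μ0 X0 contDiff_fst contDiff_snd)
    (contDiff_UtilD contDiff_fst contDiff_snd) fun v => by
      have hv : ∀ t < ℓ, UtilD (0 : Fin ℓ → Fin m → ℝ) (fun s : Fin ℓ => v s) t = v t :=
        fun t ht => UtilD_zero _ ht
      refine ⟨(0, fun s => v s), fun t ht => ⟨hv t ht, ?_⟩⟩
      refine (XtilSeqD_zero A B SigAp SigBp μ0 X0 _ t).trans (ldsTV_congr _ _ fun s hs => ?_)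
      simp only [hv s (hs.trans ht)]
  filter_upwards [hZ, hD] with ρ h1 h2
  rw [ZmatD_eq_dataMat, DmatD_eq_dataMat]
  exact ⟨h1, h2⟩

end MultNoise
end
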